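/- arXiv:math/9805100 — 2 statements merged into one kernel-verified Lean document; each statement's English description precedes it below -/
import Mathlib

section
/- For a simple n-dimensional convex polytope Δ defined by an irredundant system of inequalities α_i·v ≥ 0 (i = 1,…,f), the volume of the perturbed polytope Δ(ε) = {v : α_i·v ≥ ε_i} is, for ε in a sufficiently small neighborhood of 0 in ℝ^f, given by a polynomial of total degree n in the variables ε_1,…,ε_f. -/
open MeasureTheory Matrix
namespace VolPoly

/-- partial derivative -/
noncomputable def D {f : ℕ} (i : Fin f) (g : (Fin f → ℝ) → ℝ) : (Fin f → ℝ) → ℝ :=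
  fun x => fderiv ℝ g x (Pi.single i 1)

/-- iterated partial derivative -/
noncomputable def DL {f : ℕ} (l : List (Fin f)) (g : (Fin f → ℝ) → ℝ) : (Fin f → ℝ) → ℝ :=
  l.foldr D g

/-- invariance along a direction -/
def Inv {f : ℕ} (B : Set (Fin f → ℝ)) (u : Fin f → ℝ) (g : (Fin f → ℝ) → ℝ) : Prop :=
  ∀ t : ℝ, ∀ x ∈ B, x + t • u ∈ B → g (x + t • u) = g x

lemma smooth_D {f : ℕ} (i : Fin f) {g : (Fin f → ℝ) → ℝ} (hg : ContDiff ℝ (⊤ : ℕ∞) g) :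
    ContDiff ℝ (⊤ : ℕ∞) (D i g) := by
  have h := hg.fderiv_right (m := ((⊤ : ℕ∞) : WithTop ℕ∞)) (by simp)
  exact h.clm_apply contDiff_const

lemma smooth_DL {f : ℕ} (l : List (Fin f)) {g : (Fin f → ℝ) → ℝ}
    (hg : ContDiff ℝ (⊤ : ℕ∞) g) : ContDiff ℝ (⊤ : ℕ∞) (DL l g) := by
  induction l with
  | nil => exact hg
  | cons i l ih => exact smooth_D i ih

lemma inv_D {f : ℕ} {B : Set (Fin f → ℝ)} (hB : IsOpen B) {u : Fin f → ℝ}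
    {g : (Fin f → ℝ) → ℝ} (hg : Inv B u g) (i : Fin f) : Inv B u (D i g) := by
  intro t x hx hxu
  have h : (fun y => g (y + t • u)) =ᶠ[nhds x] g := by
    have h1 : ∀ᶠ y in nhds x, y ∈ B := hB.mem_nhds hx
    have h2 : ∀ᶠ y in nhds x, y + t • u ∈ B := by
      have hc : Continuous (fun y : Fin f → ℝ => y + t • u) := by fun_prop
      exact hc.continuousAt.eventually (hB.mem_nhds hxu)
    filter_upwards [h1, h2] with y a1 a2 using hg t y a1 a2
  have := h.fderiv_eq (𝕜 := ℝ)
  rw [fderiv_comp_add_right] at this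
  simp only [D, this]

lemma inv_DL {f : ℕ} {B : Set (Fin f → ℝ)} (hB : IsOpen B) {u : Fin f → ℝ}
    {g : (Fin f → ℝ) → ℝ} (hg : Inv B u g) (l : List (Fin f)) : Inv B u (DL l g) := by
  induction l with
  | nil => exact hg
  | cons i l ih => exact inv_D hB ih i

lemma inv_zero {f : ℕ} {B : Set (Fin f → ℝ)} (hB : IsOpen B) {u : Fin f → ℝ}
    {g : (Fin f → ℝ) → ℝ} (hg : Inv B u g) {x : Fin f → ℝ} (hx : x ∈ B)
    (hd : DifferentiableAt ℝ g x) : fderiv ℝ g x u = 0 := by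
  have h1 : HasDerivAt (fun t : ℝ => g (x + t • u)) (fderiv ℝ g x u) 0 :=
    hd.hasFDerivAt.hasLineDerivAt u
  have h2 : (fun t : ℝ => g (x + t • u)) =ᶠ[nhds 0] fun _ => g x := by
    have hc : Continuous (fun t : ℝ => x + t • u) := by fun_prop
    have : ∀ᶠ t in nhds (0 : ℝ), x + t • u ∈ B :=
      hc.continuousAt.eventually (hB.mem_nhds (by simpa using hx))
    filter_upwards [this] with t ht using hg t x hx ht
  exact (h1.congr_of_eventuallyEq h2.symm).unique (hasDerivAt_const (0 : ℝ) (g x))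

lemma DL_zero {f : ℕ} {g : (Fin f → ℝ) → ℝ} (hs : ContDiff ℝ (⊤ : ℕ∞) g) {i : Fin f}
    (hg : Inv Set.univ (Pi.single i 1) g) {l : List (Fin f)} (hl : i ∈ l) : DL l g = 0 := by
  induction l with
  | nil => simp at hl
  | cons j l ih =>
    by_cases h : i ∈ l
    · have := ih h
      change D j (DL l g) = 0
      rw [this]; ext x; simp [D]
    · have hij : i = j := by simpa [h] using hl
      subst hij
      ext x
      exact inv_zero isOpen_univ (inv_DL isOpen_univ hg l) (Set.mem_univ x)
        ((smooth_DL l hs).differentiable (by simp) x)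

lemma DL_sum {f : ℕ} {ι : Type*} (s : Finset ι) (g : ι → (Fin f → ℝ) → ℝ)
    (hs : ∀ k ∈ s, ContDiff ℝ (⊤ : ℕ∞) (g k)) (l : List (Fin f)) :
    DL l (fun x => ∑ k ∈ s, g k x) = fun x => ∑ k ∈ s, DL l (g k) x := by
  induction l with
  | nil => rfl
  | cons j l ih =>
    change D j (DL l _) = _
    rw [ih]
    ext x
    simp only [D]
    rw [fderiv_fun_sum (fun k hk => (smooth_DL l (hs k hk)).differentiable (by simp) x)]
    simp [DL, D]

lemma fderiv_eq_sum {f : ℕ} (g : (Fin f → ℝ) → ℝ) (x u : Fin f → ℝ) :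
    fderiv ℝ g x u = ∑ i, u i * D i g x := by
  conv_lhs => rw [pi_eq_sum_univ' u]
  simp only [map_sum, map_smul, smul_eq_mul, D]

/-- polynomials with all monomials of degree `< d`. -/
def PolyOn {f : ℕ} (B : Set (Fin f → ℝ)) (d : ℕ) (g : (Fin f → ℝ) → ℝ) : Prop :=
  ∃ p ∈ MvPolynomial.restrictSupport ℝ {m : Fin f →₀ ℕ | m.degree < d},
    ∀ x ∈ B, g x = MvPolynomial.eval x p

lemma PolyOn.sum {f : ℕ} {B : Set (Fin f → ℝ)} {d : ℕ} {ι : Type*} (s : Finset ι)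
    (c : ι → ℝ) (g : ι → (Fin f → ℝ) → ℝ) (h : ∀ i ∈ s, c i ≠ 0 → PolyOn B d (g i)) :
    PolyOn B d (fun x => ∑ i ∈ s, c i * g i x) := by
  have : ∀ i, ∃ p ∈ MvPolynomial.restrictSupport ℝ {m : Fin f →₀ ℕ | m.degree < d},
    i ∈ s → ∀ x ∈ B, c i * g i x = MvPolynomial.eval x p := by
    intro i
    by_cases hi : i ∈ s
    · by_cases hc : c i = 0
      · exact ⟨0, Submodule.zero_mem _, by simp [hc]⟩
      · obtain ⟨p, hp, h⟩ := h i hi hc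
        refine ⟨c i • p, Submodule.smul_mem _ _ hp, fun _ x hx => ?_⟩
        simp [h x hx, MvPolynomial.smul_eval]
    · exact ⟨0, Submodule.zero_mem _, by simp [hi]⟩
  choose p hp hpe using this
  refine ⟨∑ i ∈ s, p i, Submodule.sum_mem _ fun i _ => hp i, fun x hx => ?_⟩
  rw [map_sum]
  exact Finset.sum_congr rfl fun i hi => hpe i hi x hx

lemma PolyOn.integrate {f : ℕ} {r : ℝ} {d : ℕ} {g : (Fin f → ℝ) → ℝ}
    (hg : Differentiable ℝ g) (h : ∀ i, PolyOn (Metric.ball 0 r) d (D i g)) :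
    PolyOn (Metric.ball 0 r) (d + 1) g := by
  choose p hp hpe using h
  set Q : MvPolynomial (Fin f) ℝ := ∑ i, ∑ m ∈ (p i).support,
    MvPolynomial.monomial (m + Finsupp.single i 1) ((p i).coeff m / (m.degree + 1)) with hQ
  have hQe : ∀ (x : Fin f → ℝ) (t : ℝ), MvPolynomial.eval (t • x) Q =
      ∑ i, ∑ m ∈ (p i).support, (p i).coeff m / (m.degree + 1) *
        (t ^ (m.degree + 1) * ((∏ j, x j ^ m j) * x i)) := by
    intro x t
    rw [hQ, map_sum]
    refine Finset.sum_congr rfl fun i _ => ?_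
    rw [map_sum]
    refine Finset.sum_congr rfl fun m _ => ?_
    rw [MvPolynomial.eval_monomial, Finsupp.prod_fintype _ _ (by simp)]
    congr 1
    simp only [Finsupp.add_apply, pow_add, Finset.prod_mul_distrib, Pi.smul_apply, smul_eq_mul,
      mul_pow, Finset.prod_pow_eq_pow_sum, Finsupp.degree_eq_sum]
    have : ∀ y : Fin f → ℝ, ∏ j, y j ^ (Finsupp.single i 1 : Fin f →₀ ℕ) j = y i := by
      intro y
      rw [Finset.prod_eq_single i] <;> simp +contextual [eq_comm]
    have h1 : (∑ j, (Finsupp.single i 1 : Fin f →₀ ℕ) j) = 1 := by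
      rw [← Finsupp.degree_eq_sum]; simp
    rw [this, h1]
    ring
  have hQd : ∀ (x : Fin f → ℝ) (t : ℝ), HasDerivAt (fun t : ℝ => MvPolynomial.eval (t • x) Q)
      (∑ i, x i * MvPolynomial.eval (t • x) (p i)) t := by
    intro x t
    simp only [hQe]
    have : (∑ i, x i * MvPolynomial.eval (t • x) (p i)) =
        ∑ i, ∑ m ∈ (p i).support, (p i).coeff m / (m.degree + 1) *
        ((((m.degree + 1 : ℕ) : ℝ) * t ^ (m.degree + 1 - 1)) * ((∏ j, x j ^ m j) * x i)) := by
      refine Finset.sum_congr rfl fun i _ => ?_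
      rw [MvPolynomial.eval_eq', Finset.mul_sum]
      refine Finset.sum_congr rfl fun m _ => ?_
      simp only [Pi.smul_apply, smul_eq_mul, mul_pow, Finset.prod_mul_distrib,
        Finset.prod_pow_eq_pow_sum, Nat.add_sub_cancel, ← Finsupp.degree_eq_sum]
      have : ((m.degree : ℝ) + 1) ≠ 0 := by positivity
      push_cast
      field_simp
    rw [this]
    refine HasDerivAt.fun_sum fun i _ => HasDerivAt.fun_sum fun m _ => ?_
    exact ((hasDerivAt_pow _ t).mul_const _).const_mul _
  refine ⟨MvPolynomial.C (g 0) + Q, ?_, ?_⟩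
  · refine Submodule.add_mem _ ?_ (Submodule.sum_mem _ fun i _ => Submodule.sum_mem _ fun m hm => ?_)
    · rw [MvPolynomial.mem_restrictSupport_iff]
      intro m hm
      have := MvPolynomial.support_monomial_subset hm
      simp at this
      simp [this]
    · have h1 := hp i
      rw [MvPolynomial.mem_restrictSupport_iff] at h1 ⊢
      intro m' hm'
      have h2 := MvPolynomial.support_monomial_subset hm'
      simp only [Finset.mem_singleton] at h2
      have := h1 hm
      simp only [Set.mem_ofPred_eq] at this ⊢
      rw [h2, map_add]
      simp; omega
  · intro x hx
    have hseg : ∀ t ∈ Set.Icc (0 : ℝ) 1, t • x ∈ Metric.ball (0 : Fin f → ℝ) r := by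
      intro t ht
      simp only [mem_ball_zero_iff, norm_smul, Real.norm_eq_abs, abs_of_nonneg ht.1] at hx ⊢
      nlinarith [norm_nonneg x, ht.2]
    have hG : ∀ t ∈ Set.Icc (0 : ℝ) 1, HasDerivAt
        (fun t : ℝ => g (t • x) - MvPolynomial.eval (t • x) Q) 0 t := by
      intro t ht
      have h1 : HasDerivAt (fun t : ℝ => g (t • x)) (fderiv ℝ g (t • x) x) t := by
        have hl : HasDerivAt (fun t : ℝ => t • x) x t := by
          simpa using (hasDerivAt_id t).smul_const x
        exact (hg (t • x)).hasFDerivAt.comp_hasDerivAt t hl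
      have h2 := h1.sub (hQd x t)
      have h3 : fderiv ℝ g (t • x) x - ∑ i, x i * MvPolynomial.eval (t • x) (p i) = 0 := by
        rw [fderiv_eq_sum, sub_eq_zero]
        exact Finset.sum_congr rfl fun i _ => by rw [hpe i _ (hseg t ht)]
      rw [h3] at h2
      exact h2
    have hc := constant_of_has_deriv_right_zero
      (fun t ht => (hG t ht).continuousAt.continuousWithinAt)
      (fun t ht => (hG t ⟨ht.1, ht.2.le⟩).hasDerivWithinAt) 1 (by simp)
    simp only [one_smul, zero_smul] at hc
    have h0 : MvPolynomial.eval (0 : Fin f → ℝ) Q = 0 := by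
      have := hQe 0 0
      simpa using this
    rw [h0] at hc
    simp; linarith

/-- The core differential argument. -/
lemma core {f n : ℕ} {r : ℝ} {ι : Type*} (s : Finset ι)
    (α : Fin f → Fin n → ℝ)
    (A : ι → Finset (Fin f)) (hA : ∀ k ∈ s, (A k).card ≤ n)
    (hdual : ∀ k ∈ s, ∀ i ∈ A k, ∃ w : Fin n → ℝ, ∀ j ∈ A k, α j ⬝ᵥ w = if j = i then 1 else 0)
    (g : ι → (Fin f → ℝ) → ℝ) (hs : ∀ k ∈ s, ContDiff ℝ (⊤ : ℕ∞) (g k))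
    (hgA : ∀ k ∈ s, ∀ i, i ∉ A k → Inv Set.univ (Pi.single i 1) (g k))
    (hinv : ∀ w : Fin n → ℝ, Inv (Metric.ball 0 r) (fun i => α i ⬝ᵥ w) (fun x => ∑ k ∈ s, g k x)) :
    PolyOn (Metric.ball 0 r) (n + 1) (fun x => ∑ k ∈ s, g k x) := by
  set W : (Fin f → ℝ) → ℝ := fun x => ∑ k ∈ s, g k x with hW
  have hWs : ContDiff ℝ (⊤ : ℕ∞) W := ContDiff.sum fun k hk => hs k hk
  have hvan : ∀ l : List (Fin f), (∀ k ∈ s, ∃ i ∈ l, i ∉ A k) → DL l W = 0 := by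
    intro l hl
    rw [hW, DL_sum s g hs l]
    ext x
    refine Finset.sum_eq_zero fun k hk => ?_
    obtain ⟨i, hi, hiA⟩ := hl k hk
    rw [DL_zero (hs k hk) (hgA k hk i hiA) hi]; rfl
  have key : ∀ d : ℕ, ∀ l : List (Fin f), l.Nodup → l.length + d = n + 1 →
      PolyOn (Metric.ball 0 r) d (DL l W) := by
    intro d
    induction d with
    | zero =>
      intro l hl hlen
      refine ⟨0, Submodule.zero_mem _, fun x _ => ?_⟩
      rw [hvan l]; · simp
      intro k hk
      by_contra! hcon
      have h1 : l.toFinset ⊆ A k := fun i hi => hcon i (by simpa using hi)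
      have h2 := Finset.card_le_card h1
      rw [List.toFinset_card_of_nodup hl] at h2
      have := hA k hk
      omega
    | succ d ih =>
      intro l hl hlen
      by_cases hv : ∀ k ∈ s, ∃ i ∈ l, i ∉ A k
      · rw [hvan l hv]
        exact ⟨0, Submodule.zero_mem _, fun x _ => by simp⟩
      push Not at hv
      obtain ⟨k, hk, hlk⟩ := hv
      have hnot : ∀ i, i ∉ l → PolyOn (Metric.ball 0 r) d (D i (DL l W)) := by
        intro i hi
        exact ih (i :: l) (List.nodup_cons.2 ⟨hi, hl⟩) (by simp; omega)
      refine PolyOn.integrate ((smooth_DL l hWs).differentiable (by simp)) fun i => ?_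
      by_cases hi : i ∈ l
      · obtain ⟨w, hw⟩ := hdual k hk i (hlk i hi)
        obtain ⟨p, hp, hpe⟩ := PolyOn.sum (B := Metric.ball 0 r) (d := d) (Finset.univ.erase i)
          (fun j => -(α j ⬝ᵥ w)) (fun j => D j (DL l W)) (by
            intro j hj hne
            apply hnot
            intro hjl
            apply hne
            rw [hw j (hlk j hjl)]
            simp at hj
            simp [hj])
        refine ⟨p, hp, fun x hx => ?_⟩
        rw [← hpe x hx]
        have h0 := inv_zero Metric.isOpen_ball (inv_DL Metric.isOpen_ball (hinv w) l) hx
          ((smooth_DL l hWs).differentiable (by simp) x)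
        rw [fderiv_eq_sum, ← Finset.add_sum_erase _ _ (Finset.mem_univ i),
          hw i (hlk i hi)] at h0
        simp only [if_true, one_mul, neg_mul, Finset.sum_neg_distrib] at h0 ⊢
        linarith
      · exact hnot i hi
  exact key (n + 1) [] List.nodup_nil (by simp)


/-- Dual vectors for the active constraints at any point of a simple polytope. -/
lemma dual_exists {n f : ℕ} (α : Fin f → (Fin n → ℝ)) (b : Fin f → ℝ)
    (hcompact : IsCompact {v | ∀ i, b i ≤ α i ⬝ᵥ v})
    (hsimple : ∀ v ∈ Set.extremePoints ℝ {v | ∀ i, b i ≤ α i ⬝ᵥ v},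
      {i : Fin f | α i ⬝ᵥ v = b i}.ncard = n)
    (v : Fin n → ℝ) (hv : ∀ i, b i ≤ α i ⬝ᵥ v) :
    (Finset.univ.filter fun i => α i ⬝ᵥ v = b i).card ≤ n ∧
    ∃ w : Fin f → Fin n → ℝ, ∀ i, α i ⬝ᵥ v = b i → ∀ j, α j ⬝ᵥ v = b j →
      α j ⬝ᵥ w i = if j = i then 1 else 0 := by
  set K : Set (Fin n → ℝ) := {v | ∀ i, b i ≤ α i ⬝ᵥ v} with hK
  set F : Set (Fin n → ℝ) := {u | u ∈ K ∧ ∀ i, α i ⬝ᵥ v = b i → α i ⬝ᵥ u = b i} with hF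
  have hFext : IsExtreme ℝ K F := by
    refine ⟨fun u hu => hu.1, ?_⟩
    rintro x hx y hy z hz ⟨p, q, hp, hq, hpq, rfl⟩
    refine ⟨hx, fun i hi => ?_⟩
    have h1 := hz.2 i hi
    rw [dotProduct_add, dotProduct_smul, dotProduct_smul, smul_eq_mul, smul_eq_mul] at h1
    have h2 := hx i
    have h3 := hy i
    have hq' : q = 1 - p := by linarith
    subst hq'
    nlinarith
  have hFc : IsCompact F := by
    have : F = K ∩ {u | ∀ i, α i ⬝ᵥ v = b i → α i ⬝ᵥ u = b i} := rfl
    rw [this]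
    apply hcompact.inter_right
    have : {u | ∀ i, α i ⬝ᵥ v = b i → α i ⬝ᵥ u = b i} =
      ⋂ i, ⋂ (_ : α i ⬝ᵥ v = b i), {u | α i ⬝ᵥ u = b i} := by ext; simp
    rw [this]
    exact isClosed_iInter fun i => isClosed_iInter fun _ =>
      isClosed_eq (Continuous.dotProduct continuous_const continuous_id) continuous_const
  obtain ⟨x, hx⟩ := hFc.extremePoints_nonempty ⟨v, hv, fun i hi => hi⟩
  have hxF : x ∈ F := extremePoints_subset hx
  have hxK := hFext.extremePoints_subset_extremePoints hx
  have hcard := hsimple x hxK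
  set A : Finset (Fin f) := Finset.univ.filter fun i => α i ⬝ᵥ x = b i with hA
  have hAcard : A.card = n := by
    rw [← hcard, ← Set.ncard_coe_finset]
    congr 1; ext; simp [hA]
  refine ⟨?_, ?_⟩
  · refine le_of_le_of_eq (Finset.card_le_card ?_) hAcard
    intro i hi
    simp only [Finset.mem_filter, Finset.mem_univ, true_and, hA] at hi ⊢
    exact hxF.2 i hi
  let L : (Fin n → ℝ) →ₗ[ℝ] (A → ℝ) :=
    { toFun := fun w i => α i ⬝ᵥ w
      map_add' := fun w w' => by ext; simp
      map_smul' := fun c w => by ext; simp }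
  have hinj : Function.Injective L := by
    rw [← LinearMap.ker_eq_bot, LinearMap.ker_eq_bot']
    intro w hw
    have hw' : ∀ i, α i ⬝ᵥ x = b i → α i ⬝ᵥ w = 0 := by
      intro i hi
      exact congrFun hw ⟨i, by simp [hA, hi]⟩
    have hev : ∀ᶠ t in nhds (0 : ℝ), ∀ i, b i ≤ α i ⬝ᵥ (x + t • w) := by
      rw [Filter.eventually_all]
      intro i
      by_cases hi : α i ⬝ᵥ x = b i
      · refine Filter.Eventually.of_forall fun t => ?_
        simp [dotProduct_add, dotProduct_smul, hw' i hi, hi]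
      · have hlt : b i < α i ⬝ᵥ (x + (0 : ℝ) • w) := by
          simpa using lt_of_le_of_ne (hxF.1 i) (Ne.symm hi)
        have hc : Continuous fun t : ℝ => α i ⬝ᵥ (x + t • w) :=
          Continuous.dotProduct continuous_const (by fun_prop)
        filter_upwards [hc.continuousAt.eventually (lt_mem_nhds hlt)] with t ht using ht.le
    have hev' : ∀ᶠ t in nhds (0 : ℝ), ∀ i, b i ≤ α i ⬝ᵥ (x + (-t) • w) := by
      have : Filter.Tendsto (fun t : ℝ => -t) (nhds 0) (nhds 0) := by
        simpa using (continuous_neg (G := ℝ)).tendsto 0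
      exact this.eventually hev
    obtain ⟨t, ⟨h1, h2⟩, ht⟩ := (((hev.and hev').filter_mono
      (nhdsWithin_le_nhds (s := Set.Ioi 0))).and (self_mem_nhdsWithin)).exists
    have ht : 0 < t := ht
    have h3 := hxK.2 h1 h2 ⟨1/2, 1/2, by norm_num, by norm_num, by norm_num, by
      ext j; simp; ring⟩
    have h4 : t • w = 0 := by simpa using h3
    exact (smul_eq_zero.1 h4).resolve_left ht.ne'
  have hsurj : Function.Surjective L :=
    (LinearMap.injective_iff_surjective_of_finrank_eq_finrank (by simp [hAcard])).1 hinj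
  have : ∀ i : Fin f, ∃ w : Fin n → ℝ, L w = fun j : A => if (j : Fin f) = i then 1 else 0 :=
    fun i => hsurj _
  choose w hw using this
  refine ⟨w, fun i _ j hj => ?_⟩
  exact congrFun (hw i) ⟨j, by simp [hA, hxF.2 j hj]⟩

lemma subset_of_near {n f : ℕ} (α : Fin f → (Fin n → ℝ)) (b : Fin f → ℝ)
    (v₀ : Fin n → ℝ) (hv₀ : ∀ i, b i < α i ⬝ᵥ v₀) (L : Set (Fin n → ℝ)) (hL : IsCompact L)
    (hKL : {v | ∀ i, b i ≤ α i ⬝ᵥ v} ⊆ interior L) :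
    ∀ᶠ ε in nhds (0 : Fin f → ℝ), {v | ∀ i, b i + ε i ≤ α i ⬝ᵥ v} ⊆ L := by
  have hFc : IsCompact (frontier L) := hL.of_isClosed_subset isClosed_frontier
    hL.isClosed.frontier_subset
  have h1 : ∀ᶠ ε in nhds (0 : Fin f → ℝ), ∀ u ∈ frontier L, ∃ i, α i ⬝ᵥ u < b i + ε i := by
    refine hFc.eventually_forall_of_forall_eventually fun u hu => ?_
    have : ∃ i, α i ⬝ᵥ u < b i := by
      by_contra! hcon
      exact hu.2 (hKL hcon)
    obtain ⟨i, hi⟩ := this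
    have hc1 : Continuous fun z : (Fin f → ℝ) × (Fin n → ℝ) => α i ⬝ᵥ z.2 :=
      Continuous.dotProduct continuous_const continuous_snd
    have hc2 : Continuous fun z : (Fin f → ℝ) × (Fin n → ℝ) => b i + z.1 i := by fun_prop
    have := (isOpen_lt hc1 hc2).mem_nhds (show ((0 : Fin f → ℝ), u) ∈ _ by simpa using hi)
    filter_upwards [this] with z hz using ⟨i, hz⟩
  have h2 : ∀ᶠ ε in nhds (0 : Fin f → ℝ), ∀ i, b i + ε i < α i ⬝ᵥ v₀ := by
    rw [Filter.eventually_all]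
    intro i
    have hc2 : Continuous fun z : (Fin f → ℝ) => b i + z i := by fun_prop
    exact hc2.continuousAt.eventually (gt_mem_nhds (by simpa using hv₀ i))
  filter_upwards [h1, h2] with ε h1 h2
  have hconv : Convex ℝ {v | ∀ i, b i + ε i ≤ α i ⬝ᵥ v} := by
    intro x hx y hy p q hp hq hpq i
    rw [dotProduct_add, dotProduct_smul, dotProduct_smul, smul_eq_mul, smul_eq_mul]
    have h2 := hx i
    have h3 := hy i
    have hq' : q = 1 - p := by linarith
    subst hq'
    nlinarith
  refine (hconv.isPreconnected.subset_left_of_subset_union isOpen_interior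
    hL.isClosed.isOpen_compl ?_ ?_ ?_).trans interior_subset
  · exact Set.disjoint_left.2 fun u hu hu' => hu' (interior_subset hu)
  · intro u hu
    by_cases hul : u ∈ L
    · left
      by_contra hcon
      obtain ⟨i, hi⟩ := h1 u ⟨subset_closure hul, hcon⟩
      exact absurd (hu i) (not_le.2 hi)
    · exact Or.inr hul
  · exact ⟨v₀, fun i => (h2 i).le, hKL fun i => (hv₀ i).le⟩

lemma isClosed_cone {n f : ℕ} (α : Fin f → (Fin n → ℝ)) (b : Fin f → ℝ) (A : Finset (Fin f)) :
    IsClosed {v : Fin n → ℝ | ∀ i ∈ A, b i ≤ α i ⬝ᵥ v} := by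
  have : {v : Fin n → ℝ | ∀ i ∈ A, b i ≤ α i ⬝ᵥ v} =
    ⋂ i, ⋂ (_ : i ∈ A), {u | b i ≤ α i ⬝ᵥ u} := by ext; simp
  rw [this]
  exact isClosed_iInter fun i => isClosed_iInter fun _ =>
    isClosed_le continuous_const (Continuous.dotProduct continuous_const continuous_id)

/-- local volume piece -/
noncomputable def piece {n f : ℕ} (α : Fin f → (Fin n → ℝ)) (b : Fin f → ℝ) (A : Finset (Fin f))
    (φ : (Fin n → ℝ) → ℝ) (ε : Fin f → ℝ) : ℝ :=
  ∫ v, Set.indicator {v : Fin n → ℝ | ∀ i ∈ A, b i + ε i ≤ α i ⬝ᵥ v} φ v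

lemma piece_inv {n f : ℕ} (α : Fin f → (Fin n → ℝ)) (b : Fin f → ℝ) (A : Finset (Fin f))
    (φ : (Fin n → ℝ) → ℝ) (i : Fin f) (hi : i ∉ A) :
    Inv Set.univ (Pi.single i 1) (piece α b A φ) := by
  intro t x _ _
  unfold piece
  congr 1
  have : {v : Fin n → ℝ | ∀ j ∈ A, b j + (x + t • (Pi.single i 1 : Fin f → ℝ)) j ≤ α j ⬝ᵥ v} =
      {v : Fin n → ℝ | ∀ j ∈ A, b j + x j ≤ α j ⬝ᵥ v} := by
    ext v
    refine forall₂_congr fun j hj => ?_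
    have hji : j ≠ i := fun h => hi (h ▸ hj)
    simp [hji]
  rw [this]

open scoped Convolution in
lemma piece_smooth {n f : ℕ} (α : Fin f → (Fin n → ℝ)) (b : Fin f → ℝ) (A : Finset (Fin f))
    (φ : (Fin n → ℝ) → ℝ) (hφ : ContDiff ℝ (⊤ : ℕ∞) φ) (hc : HasCompactSupport φ)
    (w : Fin f → Fin n → ℝ) (hw : ∀ i ∈ A, ∀ j ∈ A, α j ⬝ᵥ w i = if j = i then 1 else 0) :
    ContDiff ℝ (⊤ : ℕ∞) (piece α b A φ) := by
  set C : Set (Fin n → ℝ) := {v : Fin n → ℝ | ∀ i ∈ A, b i ≤ α i ⬝ᵥ v} with hC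
  set ρ : (Fin n → ℝ) → ℝ := Set.indicator ((fun u => -u) ⁻¹' C) (fun _ => 1) with hρ
  have hmeas : MeasurableSet ((fun u : Fin n → ℝ => -u) ⁻¹' C) :=
    ((isClosed_cone α b A).preimage continuous_neg).measurableSet
  have hρi : LocallyIntegrable ρ volume :=
    (locallyIntegrable_const (1 : ℝ)).indicator hmeas
  have hsm : ContDiff ℝ (⊤ : ℕ∞) (φ ⋆[ContinuousLinearMap.mul ℝ ℝ, volume] ρ) :=
    hc.contDiff_convolution_left _ hφ hρi
  have hT : ContDiff ℝ (⊤ : ℕ∞) fun ε : Fin f → ℝ => ∑ i ∈ A, ε i • w i := by fun_prop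
  convert hsm.comp hT using 1
  ext ε
  simp only [piece, Function.comp, convolution]
  refine integral_congr_ae (Filter.Eventually.of_forall fun v => ?_)
  have hiff : v ∈ {v : Fin n → ℝ | ∀ i ∈ A, b i + ε i ≤ α i ⬝ᵥ v} ↔
      (∑ i ∈ A, ε i • w i) - v ∈ (fun u : Fin n → ℝ => -u) ⁻¹' C := by
    refine forall₂_congr fun j hj => ?_
    have : α j ⬝ᵥ (∑ i ∈ A, ε i • w i) = ε j := by
      rw [dotProduct_sum, Finset.sum_congr rfl (fun i hi => by
        rw [dotProduct_smul, hw i hi j hj])]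
      simp [hj]
    change _ ↔ b j ≤ α j ⬝ᵥ (-(∑ i ∈ A, ε i • w i - v))
    rw [neg_sub, dotProduct_sub, this]
    constructor <;> intro h <;> linarith
  by_cases h : v ∈ {v : Fin n → ℝ | ∀ i ∈ A, b i + ε i ≤ α i ⬝ᵥ v}
  · simp only [ContinuousLinearMap.mul_apply', hρ]
    rw [Set.indicator_of_mem h, Set.indicator_of_mem (hiff.1 h), mul_one]
  · simp only [ContinuousLinearMap.mul_apply', hρ]
    rw [Set.indicator_of_notMem h, Set.indicator_of_notMem (fun h' => h (hiff.2 h')), mul_zero]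


open scoped Manifold ContDiff in
lemma local_poly {n f : ℕ} (α : Fin f → (Fin n → ℝ)) (b : Fin f → ℝ)
    (hcompact : IsCompact {v | ∀ i, b i ≤ α i ⬝ᵥ v})
    (hsimple : ∀ v ∈ Set.extremePoints ℝ {v | ∀ i, b i ≤ α i ⬝ᵥ v},
      {i : Fin f | α i ⬝ᵥ v = b i}.ncard = n)
    (v₀ : Fin n → ℝ) (hv₀ : ∀ i, b i < α i ⬝ᵥ v₀) :
    ∃ r > 0, PolyOn (Metric.ball 0 r) (n + 1)
      (fun ε => (volume {v : Fin n → ℝ | ∀ i, b i + ε i ≤ α i ⬝ᵥ v}).toReal) := by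
  set K : Set (Fin n → ℝ) := {v | ∀ i, b i ≤ α i ⬝ᵥ v} with hK
  let A : (Fin n → ℝ) → Finset (Fin f) := fun v => Finset.univ.filter fun i => α i ⬝ᵥ v = b i
  let U : (Fin n → ℝ) → Set (Fin n → ℝ) := fun v =>
    (⋂ i, ⋂ (_ : i ∉ A v), {u | (α i ⬝ᵥ v + b i) / 2 < α i ⬝ᵥ u}) ∩ Metric.ball v 1
  have hUo : ∀ v, IsOpen (U v) := by
    intro v
    refine IsOpen.inter ?_ Metric.isOpen_ball
    exact isOpen_iInter_of_finite fun i => isOpen_iInter_of_finite fun _ =>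
      isOpen_lt continuous_const (Continuous.dotProduct continuous_const continuous_id)
  have hlt : ∀ v ∈ K, ∀ i, i ∉ A v → b i < α i ⬝ᵥ v := by
    intro v hv i hi
    refine lt_of_le_of_ne (hv i) fun h => hi ?_
    simp [A, h]
  have hUm : ∀ v ∈ K, v ∈ U v := by
    intro v hv
    refine ⟨?_, by simp⟩
    simp only [Set.mem_iInter]
    intro i hi
    have := hlt v hv i hi
    change (α i ⬝ᵥ v + b i) / 2 < α i ⬝ᵥ v
    linarith
  obtain ⟨t, htK, htU⟩ := hcompact.elim_nhds_subcover U
    (fun v hv => (hUo v).mem_nhds (hUm v hv))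
  obtain ⟨L, hL, hKL, hLU⟩ := exists_compact_between hcompact
    (isOpen_biUnion fun x (_ : x ∈ t) => hUo x) htU
  obtain ⟨φ, hφ⟩ := SmoothPartitionOfUnity.exists_isSubordinate 𝓘(ℝ, Fin n → ℝ) hL.isClosed
    (fun k : t => U k) (fun k => hUo k) (by
      intro x hx
      have := hLU hx
      simp only [Set.mem_iUnion] at this ⊢
      obtain ⟨k, hk, hxk⟩ := this
      exact ⟨⟨k, hk⟩, hxk⟩)
  have hφs : ∀ k, ContDiff ℝ (⊤ : ℕ∞) (fun x => φ k x) := fun k => (φ k).contMDiff.contDiff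
  have hφc : ∀ k, HasCompactSupport (fun x => φ k x) := by
    intro k
    refine HasCompactSupport.of_support_subset_isCompact (isCompact_closedBall (k : Fin n → ℝ) 1) ?_
    intro x hx
    exact Metric.ball_subset_closedBall (hφ k (subset_closure hx)).2
  have hev1 := subset_of_near α b v₀ hv₀ L hL hKL
  have hev2 : ∀ᶠ ε in nhds (0 : Fin f → ℝ), ∀ k : t, ∀ i, i ∉ A k →
      b i + ε i < (α i ⬝ᵥ (k : Fin n → ℝ) + b i) / 2 := by
    simp only [Filter.eventually_all]
    intro k i hi
    have hc2 : Continuous fun z : (Fin f → ℝ) => b i + z i := by fun_prop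
    refine hc2.continuousAt.eventually (gt_mem_nhds ?_)
    have := hlt k (htK k k.2) i hi
    simp only [Pi.zero_apply]
    linarith
  obtain ⟨r, hr, hball⟩ := Metric.eventually_nhds_iff_ball.1 (hev1.and hev2)
  refine ⟨r, hr, ?_⟩
  have hVW : ∀ ε ∈ Metric.ball (0 : Fin f → ℝ) r,
      (volume {v : Fin n → ℝ | ∀ i, b i + ε i ≤ α i ⬝ᵥ v}).toReal =
        ∑ k : t, piece α b (A k) (fun x => φ k x) ε := by
    intro ε hε
    obtain ⟨h1, h2⟩ := hball ε hε
    have hm : MeasurableSet {v : Fin n → ℝ | ∀ i, b i + ε i ≤ α i ⬝ᵥ v} := by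
      have := (isClosed_cone α (fun i => b i + ε i) Finset.univ).measurableSet
      simpa using this
    have h3 : (volume {v : Fin n → ℝ | ∀ i, b i + ε i ≤ α i ⬝ᵥ v}).toReal =
        ∫ v, Set.indicator {v : Fin n → ℝ | ∀ i, b i + ε i ≤ α i ⬝ᵥ v} (fun _ => (1 : ℝ)) v := by
      rw [integral_indicator hm]
      simp [Measure.real]
    rw [h3]
    unfold piece
    rw [← integral_finsetSum]
    · refine integral_congr_ae (Filter.Eventually.of_forall fun v => ?_)
      by_cases hv : v ∈ {v : Fin n → ℝ | ∀ i, b i + ε i ≤ α i ⬝ᵥ v}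
      · have hs := φ.sum_eq_one (h1 hv)
        rw [finsum_eq_sum_of_fintype] at hs
        simp only []
        rw [Set.indicator_of_mem hv, ← hs]
        refine Finset.sum_congr rfl fun k _ => ?_
        rw [Set.indicator_of_mem]
        exact fun i _ => hv i
      · simp only []
        rw [Set.indicator_of_notMem hv]
        symm
        refine Finset.sum_eq_zero fun k _ => ?_
        by_cases h0 : φ k v = 0
        · simp only [Set.indicator_apply, h0, ite_self]
        · apply Set.indicator_of_notMem
          intro hvk
          apply hv
          intro i
          by_cases hi : i ∈ A k
          · exact hvk i hi
          · have hvU := (hφ k (subset_closure h0)).1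
            simp only [Set.mem_iInter] at hvU
            have h4 : (α i ⬝ᵥ (k : Fin n → ℝ) + b i) / 2 < α i ⬝ᵥ v := hvU i hi
            have h5 := h2 k i hi
            linarith
    · intro k _
      refine Integrable.indicator ((hφs k).continuous.integrable_of_hasCompactSupport (hφc k)) ?_
      exact (isClosed_cone α (fun i => b i + ε i) (A k)).measurableSet
  have hinv : ∀ w : Fin n → ℝ, Inv (Metric.ball 0 r) (fun i => α i ⬝ᵥ w)
      (fun ε => ∑ k : t, piece α b (A k) (fun x => φ k x) ε) := by
    intro w s x hx hx'
    simp only []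
    rw [← hVW _ hx, ← hVW _ hx']
    congr 1
    rw [← measure_preimage_add volume (-(s • w)) {v : Fin n → ℝ | ∀ i, b i + x i ≤ α i ⬝ᵥ v}]
    congr 1
    ext v
    refine forall_congr' fun i => ?_
    rw [dotProduct_add, dotProduct_neg, dotProduct_smul]
    simp only [Pi.add_apply, Pi.smul_apply, smul_eq_mul]
    constructor <;> intro h <;> linarith
  have hdual := fun k : t => dual_exists α b hcompact hsimple k (htK k k.2)
  have := core (r := r) (n := n) (Finset.univ : Finset t) α (fun k => A k)
    (fun k _ => (hdual k).1) (by
      intro k _ i hi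
      obtain ⟨w, hw⟩ := (hdual k).2
      refine ⟨w i, fun j hj => hw i (by simpa [A] using hi) j (by simpa [A] using hj)⟩)
    (fun k ε => piece α b (A k) (fun x => φ k x) ε)
    (by
      intro k _
      obtain ⟨w, hw⟩ := (hdual k).2
      exact piece_smooth α b (A k) _ (hφs k) (hφc k) w
        (fun i hi j hj => hw i (by simpa [A] using hi) j (by simpa [A] using hj)))
    (fun k _ i hi => piece_inv α b (A k) _ i hi) hinv
  obtain ⟨p, hp, hpe⟩ := this
  exact ⟨p, hp, fun x hx => by rw [← hpe x hx]; exact hVW x hx⟩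

open scoped Pointwise in
lemma vol_scale {n f : ℕ} (α : Fin f → (Fin n → ℝ)) (b : Fin f → ℝ) (s : ℝ) (hs : -1 < s) :
    (volume {v : Fin n → ℝ | ∀ i, b i + (s • b) i ≤ α i ⬝ᵥ v}).toReal =
      (1 + s) ^ n * (volume {v : Fin n → ℝ | ∀ i, b i ≤ α i ⬝ᵥ v}).toReal := by
  have hpos : 0 < 1 + s := by linarith
  have : {v : Fin n → ℝ | ∀ i, b i + (s • b) i ≤ α i ⬝ᵥ v} =
      (1 + s) • {v : Fin n → ℝ | ∀ i, b i ≤ α i ⬝ᵥ v} := by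
    ext v
    rw [Set.mem_smul_set_iff_inv_smul_mem₀ hpos.ne']
    refine forall_congr' fun i => ?_
    rw [dotProduct_smul, smul_eq_mul, inv_mul_eq_div, le_div_iff₀ hpos]
    simp only [Pi.smul_apply, smul_eq_mul]
    constructor <;> intro h <;> linarith
  rw [this, Measure.addHaar_smul, ENNReal.toReal_mul, ENNReal.toReal_ofReal (abs_nonneg _)]
  simp [abs_of_pos hpos]

lemma eval_line {f : ℕ} (b : Fin f → ℝ) (P : MvPolynomial (Fin f) ℝ) (s : ℝ) :
    Polynomial.eval s (MvPolynomial.aeval (fun i => Polynomial.C (b i) * Polynomial.X) P) =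
      MvPolynomial.eval (s • b) P := by
  induction P using MvPolynomial.induction_on with
  | C a => simp
  | add p q hp hq => simp [hp, hq]
  | mul_X p i hp => simp [hp, mul_comm s]

end VolPoly

/-- For a simple `n`-dimensional convex polytope `Δ` defined by an irredundant system of
inequalities `α i ⬝ᵥ v ≥ b i`, the volume of the perturbed polytope
`Δ(ε) = {v | α i ⬝ᵥ v ≥ b i + ε i}` is, for `ε` near `0`, given by a polynomial of
total degree `n` in the variables `ε i`. -/
theorem volume_polynomial_of_simple_polytope
    (n f : ℕ) (α : Fin f → (Fin n → ℝ)) (b : Fin f → ℝ)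
    (Δ : (Fin f → ℝ) → Set (Fin n → ℝ))
    (hΔ : ∀ ε, Δ ε = {v | ∀ i, α i ⬝ᵥ v ≥ b i + ε i})
    (hcompact : IsCompact (Δ 0))
    (hint : (interior (Δ 0)).Nonempty)
    (hirred : ∀ i, ∃ v, (∀ j, j ≠ i → α j ⬝ᵥ v ≥ b j) ∧ α i ⬝ᵥ v < b i)
    (hsimple : ∀ v ∈ Set.extremePoints ℝ (Δ 0),
      {i : Fin f | α i ⬝ᵥ v = b i}.ncard = n) :
    ∃ P : MvPolynomial (Fin f) ℝ, P.totalDegree = n ∧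
      ∀ᶠ ε in nhds (0 : Fin f → ℝ),
        (volume (Δ ε)).toReal = MvPolynomial.eval ε P := by
  have h0 : Δ 0 = {v | ∀ i, b i ≤ α i ⬝ᵥ v} := by rw [hΔ]; simp
  obtain ⟨v₀, hv₀⟩ := hint
  have hstrict : ∀ i, b i < α i ⬝ᵥ v₀ := by
    intro i
    obtain ⟨v, -, hv⟩ := hirred i
    have hc : Continuous fun t : ℝ => v₀ + t • (v - v₀) := by fun_prop
    have hev : ∀ᶠ t in nhds (0 : ℝ), v₀ + t • (v - v₀) ∈ Δ 0 :=
      hc.continuousAt.eventually (mem_interior_iff_mem_nhds.1 (by simpa using hv₀))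
    obtain ⟨t, ht, htpos⟩ := ((hev.filter_mono
      (nhdsWithin_le_nhds (s := Set.Ioi 0))).and self_mem_nhdsWithin).exists
    have htpos : 0 < t := htpos
    rw [h0] at ht
    have h1 := ht i
    rw [dotProduct_add, dotProduct_smul, dotProduct_sub, smul_eq_mul] at h1
    have hge : b i ≤ α i ⬝ᵥ v₀ := by
      have h2 := interior_subset hv₀
      rw [h0] at h2
      exact h2 i
    by_contra! hcon
    have heq : α i ⬝ᵥ v₀ = b i := le_antisymm hcon hge
    rw [heq] at h1
    nlinarith [mul_pos htpos (sub_pos.2 hv)]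
  have hpos : 0 < (volume (Δ 0)).toReal := by
    apply ENNReal.toReal_pos
    · exact (Measure.measure_pos_of_mem_nhds volume (mem_interior_iff_mem_nhds.1 hv₀)).ne'
    · exact hcompact.measure_lt_top.ne
  rw [h0] at hcompact hsimple hpos
  obtain ⟨r, hr, P, hP, hPe⟩ := VolPoly.local_poly α b hcompact hsimple v₀ hstrict
  have hPe' : ∀ᶠ ε in nhds (0 : Fin f → ℝ),
      (volume {v : Fin n → ℝ | ∀ i, b i + ε i ≤ α i ⬝ᵥ v}).toReal = MvPolynomial.eval ε P := by
    filter_upwards [Metric.ball_mem_nhds (0 : Fin f → ℝ) hr] with ε hε using hPe ε hε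
  refine ⟨P, le_antisymm ?_ ?_, ?_⟩
  · refine Finset.sup_le fun m hm => ?_
    have := ((MvPolynomial.mem_restrictSupport_iff ℝ).1 hP) hm
    simp only [Set.mem_ofPred_eq] at this
    exact Nat.lt_succ_iff.1 this
  · set V := (volume {v : Fin n → ℝ | ∀ i, b i ≤ α i ⬝ᵥ v}).toReal with hV
    set q : Polynomial ℝ := MvPolynomial.aeval (fun i => Polynomial.C (b i) * Polynomial.X) P
      with hq
    have hqe : ∀ s : ℝ, q.eval s = MvPolynomial.eval (s • b) P :=
      fun s => VolPoly.eval_line b P s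
    have hqdeg : q.natDegree ≤ P.totalDegree := by
      have := MvPolynomial.aeval_natDegree_le P le_rfl
        (fun i => Polynomial.C (b i) * Polynomial.X) (n := 1)
        (fun i => (Polynomial.natDegree_C_mul_le _ _).trans Polynomial.natDegree_X_le)
      simpa using this
    have hqq : q = Polynomial.C V * (Polynomial.X + Polynomial.C 1) ^ n := by
      apply Polynomial.eq_of_infinite_eval_eq
      have hc : Continuous fun s : ℝ => s • b := by fun_prop
      have h1 : ∀ᶠ s in nhds (0 : ℝ),
          (volume {v : Fin n → ℝ | ∀ i, b i + (s • b) i ≤ α i ⬝ᵥ v}).toReal =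
            MvPolynomial.eval (s • b) P := by
        have : Filter.Tendsto (fun s : ℝ => s • b) (nhds 0) (nhds 0) := by
          simpa using hc.tendsto 0
        exact this.eventually hPe'
      have h2 : ∀ᶠ s in nhds (0 : ℝ), -1 < s := lt_mem_nhds (by norm_num)
      apply infinite_of_mem_nhds (0 : ℝ)
      filter_upwards [h1, h2] with s h1 h2
      change q.eval s = _
      rw [hqe, ← h1, VolPoly.vol_scale α b s h2]
      simp
      ring
    have : q.natDegree = n := by
      rw [hqq, Polynomial.natDegree_C_mul hpos.ne', Polynomial.natDegree_pow,
        Polynomial.natDegree_X_add_C, mul_one]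
    omega
  · filter_upwards [hPe'] with ε hε
    rw [hΔ]
    exact hε
end

section
/- Let Δ be a simple n-polytope and vol_Δ the symmetric multilinear form of degree n obtained by polarizing the top-degree homogeneous part of the volume polynomial ε ↦ vol(Δ(ε)). If α_1,…,α_n are perturbations each supported on a single facet δ_1,…,δ_n respectively, and the facets δ_1,…,δ_n have empty common intersection, then vol_Δ(α_1,…,α_n) = 0. -/
open MeasureTheory Matrix

lemma sum_toggle {n : ℕ} (F : Finset (Fin n) → ℝ) (k : Fin n)
    (hF : ∀ U, k ∉ U → F (insert k U) = F U) :
    ∑ U : Finset (Fin n), (-1 : ℝ) ^ U.card * F U = 0 := by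
  rw [← Finset.powerset_univ, ← Finset.insert_erase (Finset.mem_univ k),
    Finset.sum_powerset_insert (Finset.notMem_erase k _), ← Finset.sum_add_distrib]
  apply Finset.sum_eq_zero
  intro U hU
  have hk : k ∉ U := fun h => Finset.notMem_erase k _ (Finset.mem_powerset.1 hU h)
  rw [hF U hk, Finset.card_insert_of_notMem hk, pow_succ]
  ring

lemma polar_zero {n : ℕ} {V : Type*} [AddCommGroup V] [Module ℝ V]
    (M : MultilinearMap ℝ (fun _ : Fin n => V) ℝ)
    (hM : ∀ (σ : Equiv.Perm (Fin n)) (x : Fin n → V), M (x ∘ σ) = M x)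
    (v : Fin n → V)
    (h : ∑ U : Finset (Fin n), (-1 : ℝ) ^ U.card * M (fun _ => ∑ k ∈ U, v k) = 0) :
    M v = 0 := by
  classical
  have h1 : ∀ U : Finset (Fin n), M (fun _ => ∑ k ∈ U, v k) =
      ∑ r : Fin n → Fin n, if (∀ i, r i ∈ U) then M (v ∘ r) else 0 := by
    intro U
    rw [M.map_sum_finset (fun _ k => v k) (fun _ => U), ← Finset.sum_filter]
    apply Finset.sum_congr
    · ext r; simp
    · intros; rfl
  simp_rw [h1, Finset.mul_sum] at h
  rw [Finset.sum_comm] at h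
  have h2 : ∀ r : Fin n → Fin n,
      ∑ U : Finset (Fin n), (-1 : ℝ) ^ U.card * (if (∀ i, r i ∈ U) then M (v ∘ r) else 0)
      = if Function.Surjective r then (-1 : ℝ) ^ n * M v else 0 := by
    intro r
    split_ifs with hr
    · rw [Finset.sum_eq_single Finset.univ]
      · have hb : Function.Bijective r := hr.bijective_of_finite
        have := hM (Equiv.ofBijective r hb) v
        simp only [Equiv.coe_ofBijective] at this
        simp [this]
      · intro U _ hU
        rw [if_neg, mul_zero]
        intro hall
        apply hU
        ext k
        obtain ⟨i, rfl⟩ := hr k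
        simp [hall i]
      · simp
    · obtain ⟨k, hk⟩ := not_forall.1 hr
      apply sum_toggle _ k
      intro U hU
      congr 1
      simp only [Finset.mem_insert, eq_iff_iff]
      refine forall_congr' fun i => ?_
      have : r i ≠ k := fun h => hk ⟨i, h⟩
      simp [this]
  simp_rw [h2] at h
  rw [← Finset.sum_filter, Finset.sum_const, nsmul_eq_mul] at h
  have hc : ((Finset.univ.filter fun r : Fin n → Fin n => Function.Surjective r).card : ℝ) ≠ 0 := by
    rw [Nat.cast_ne_zero]
    exact Finset.card_ne_zero_of_mem (a := id) (by simp [Function.surjective_id])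
  rcases mul_eq_zero.1 h with h | h
  · exact absurd h hc
  · rcases mul_eq_zero.1 h with h | h
    · exact absurd h (by simp)
    · exact h

lemma eval_smul_homog {f : ℕ} (P : MvPolynomial (Fin f) ℝ) (d : ℕ) (hP : P.IsHomogeneous d)
    (t : ℝ) (x : Fin f → ℝ) :
    MvPolynomial.eval (t • x) P = t ^ d * MvPolynomial.eval x P := by
  rw [MvPolynomial.eval_eq, MvPolynomial.eval_eq, Finset.mul_sum]
  apply Finset.sum_congr rfl
  intro m hm
  have := hP (MvPolynomial.mem_support_iff.1 hm)
  rw [Finsupp.weight_apply, Finsupp.sum] at this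
  simp only [Pi.smul_apply, smul_eq_mul, mul_pow, Finset.prod_mul_distrib,
    Finset.prod_pow_eq_pow_sum]
  simp only [Pi.one_apply, smul_eq_mul, mul_one] at this
  rw [this]; ring

lemma eval_smul_sum {f : ℕ} (P : MvPolynomial (Fin f) ℝ) (t : ℝ) (x : Fin f → ℝ) :
    MvPolynomial.eval (t • x) P = ∑ d ∈ Finset.range (P.totalDegree + 1),
      t ^ d * MvPolynomial.eval x (MvPolynomial.homogeneousComponent d P) := by
  conv_lhs => rw [← MvPolynomial.sum_homogeneousComponent P]
  rw [map_sum]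
  exact Finset.sum_congr rfl fun d _ => eval_smul_homog _ d
    (MvPolynomial.homogeneousComponent_isHomogeneous d P) t x

lemma coeff_zero {f : ℕ} {ι : Type*} (s : Finset ι) (c : ι → ℝ) (x : ι → Fin f → ℝ)
    (P : MvPolynomial (Fin f) ℝ) (n : ℕ) (η : ℝ) (hη : 0 < η)
    (h : ∀ t, 0 < t → t < η → ∑ u ∈ s, c u * MvPolynomial.eval (t • x u) P = 0) :
    ∑ u ∈ s, c u * MvPolynomial.eval (x u) (MvPolynomial.homogeneousComponent n P) = 0 := by
  set a : ℕ → ℝ := fun d =>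
    ∑ u ∈ s, c u * MvPolynomial.eval (x u) (MvPolynomial.homogeneousComponent d P) with ha
  by_cases hn : n < P.totalDegree + 1
  · let R : Polynomial ℝ := ∑ d ∈ Finset.range (P.totalDegree + 1),
      Polynomial.monomial d (a d)
    have hR : R = 0 := by
      apply Polynomial.eq_zero_of_infinite_isRoot
      apply (Set.Ioo_infinite hη).mono
      rintro t ⟨h0, h1⟩
      have := h t h0 h1
      simp_rw [eval_smul_sum, Finset.mul_sum] at this
      rw [Finset.sum_comm] at this
      simp only [Set.mem_ofPred_eq, Polynomial.IsRoot, R, Polynomial.eval_finsetSum,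
        Polynomial.eval_monomial]
      rw [← this]
      refine Finset.sum_congr rfl fun d _ => ?_
      rw [ha, Finset.sum_mul]
      exact Finset.sum_congr rfl fun u _ => by ring
    have := congrArg (fun p => Polynomial.coeff p n) hR
    simpa [R, Polynomial.finsetSum_coeff, Polynomial.coeff_monomial, hn] using this
  · apply Finset.sum_eq_zero
    intro u _
    rw [MvPolynomial.homogeneousComponent_eq_zero]
    · simp
    · omega

/-- Let `Δ` be a simple `n`-polytope, `P` the volume polynomial `ε ↦ vol (Δ ε)` (valid near `0`),
and `M` the symmetric multilinear form polarizing the degree-`n` homogeneous part of `P`.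
If `v 1, …, v n` are perturbations each supported on a single facet `δ 1, …, δ n` respectively,
and these facets have empty common intersection, then `M (v 1, …, v n) = 0`. -/
theorem vol_form_vanishes_of_empty_intersection
    (n f : ℕ) (α : Fin f → (Fin n → ℝ)) (b : Fin f → ℝ)
    (Δ : (Fin f → ℝ) → Set (Fin n → ℝ))
    (hΔ : ∀ ε, Δ ε = {w | ∀ i, α i ⬝ᵥ w ≥ b i + ε i})
    (hcompact : IsCompact (Δ 0))
    (hint : (interior (Δ 0)).Nonempty)
    (hirred : ∀ i, ∃ w, (∀ j, j ≠ i → α j ⬝ᵥ w ≥ b j) ∧ α i ⬝ᵥ w < b i)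
    (hsimple : ∀ w ∈ Set.extremePoints ℝ (Δ 0),
      {i : Fin f | α i ⬝ᵥ w = b i}.ncard = n)
    (P : MvPolynomial (Fin f) ℝ)
    (hP : ∀ᶠ ε in nhds (0 : Fin f → ℝ), (volume (Δ ε)).toReal = MvPolynomial.eval ε P)
    (M : MultilinearMap ℝ (fun _ : Fin n => (Fin f → ℝ)) ℝ)
    (hMsymm : ∀ (σ : Equiv.Perm (Fin n)) (x : Fin n → (Fin f → ℝ)), M (x ∘ σ) = M x)
    (hMdiag : ∀ ε : Fin f → ℝ,
      M (fun _ => ε) = MvPolynomial.eval ε (MvPolynomial.homogeneousComponent n P))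
    (δ : Fin n → Fin f) (v : Fin n → (Fin f → ℝ))
    (hsupp : ∀ k j, j ≠ δ k → v k j = 0)
    (hempty : (⋂ k, {x ∈ Δ 0 | α (δ k) ⬝ᵥ x = b (δ k)}) = ∅) :
    M v = 0 := by
  classical
  -- reduce to unit vectors
  have hv : v = fun k => (v k (δ k)) • (Pi.single (δ k) (1 : ℝ) : Fin f → ℝ) := by
    funext k j
    by_cases hj : j = δ k
    · subst hj; simp
    · simp [hsupp k j hj, hj]
  rw [hv, M.map_smul_univ]
  suffices hs : M (fun k => (Pi.single (δ k) (1 : ℝ) : Fin f → ℝ)) = 0 by rw [hs, smul_zero]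
  apply polar_zero M hMsymm
  simp_rw [hMdiag]
  set e : Finset (Fin n) → Fin f → ℝ := fun U => ∑ k ∈ U, Pi.single (δ k) (1 : ℝ) with he
  have he0 : ∀ U i, 0 ≤ e U i := by
    intro U i
    simp only [he, Finset.sum_apply]
    refine Finset.sum_nonneg fun k _ => ?_
    by_cases hj : i = δ k
    · subst hj; simp
    · simp [hj]
  have hen : ∀ U i, e U i ≤ n := by
    intro U i
    simp only [he, Finset.sum_apply]
    calc _ ≤ ∑ k ∈ U, (1 : ℝ) := Finset.sum_le_sum fun k _ => by
            by_cases hj : i = δ k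
            · subst hj; simp
            · simp [hj]
      _ ≤ n := by
        simp only [Finset.sum_const, nsmul_eq_mul, mul_one, Nat.cast_le]
        simpa using Finset.card_le_univ U
  -- uniform gap
  have hn0 : Nonempty (Fin n) := by
    by_contra hne
    rw [not_nonempty_iff] at hne
    rw [Set.iInter_of_empty] at hempty
    exact Set.empty_ne_univ hempty.symm
  have hcont : ∀ i, Continuous fun w : Fin n → ℝ => α i ⬝ᵥ w := fun i => by
    simp only [dotProduct]; fun_prop
  have hmem0 : ∀ w ∈ Δ 0, ∀ i, b i ≤ α i ⬝ᵥ w := by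
    intro w hw i
    rw [hΔ] at hw
    simpa using hw i
  obtain ⟨γ, hγ, hgap⟩ : ∃ γ > 0, ∀ w ∈ Δ 0, ∃ k, γ ≤ α (δ k) ⬝ᵥ w - b (δ k) := by
    by_cases hne : (Δ 0).Nonempty
    · have hg : Continuous fun w : Fin n → ℝ => ∑ k, (α (δ k) ⬝ᵥ w - b (δ k)) :=
        continuous_finsetSum _ fun k _ => (hcont _).sub continuous_const
      obtain ⟨w0, hw0, hmin⟩ := hcompact.exists_isMinOn hne hg.continuousOn
      have hpos : 0 < ∑ k, (α (δ k) ⬝ᵥ w0 - b (δ k)) := by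
        by_contra hle
        have hnn : ∀ k ∈ Finset.univ, 0 ≤ α (δ k) ⬝ᵥ w0 - b (δ k) :=
          fun k _ => sub_nonneg.2 (hmem0 w0 hw0 _)
        have hz := (Finset.sum_eq_zero_iff_of_nonneg hnn).1
          (le_antisymm (not_lt.1 hle) (Finset.sum_nonneg hnn))
        have : w0 ∈ (⋂ k, {x ∈ Δ 0 | α (δ k) ⬝ᵥ x = b (δ k)}) :=
          Set.mem_iInter.2 fun k => ⟨hw0, sub_eq_zero.1 (hz k (Finset.mem_univ k))⟩
        rw [hempty] at this
        exact this
      have hnpos : (0 : ℝ) < n := by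
        have := Fin.pos_iff_nonempty.2 hn0
        exact_mod_cast this
      refine ⟨(∑ k, (α (δ k) ⬝ᵥ w0 - b (δ k))) / n, div_pos hpos hnpos, fun w hw => ?_⟩
      by_contra! hlt
      have h1 : ∑ k, (α (δ k) ⬝ᵥ w0 - b (δ k)) ≤ ∑ k, (α (δ k) ⬝ᵥ w - b (δ k)) := hmin hw
      have h2 := Finset.sum_lt_sum_of_nonempty (s := Finset.univ)
        (Finset.univ_nonempty (α := Fin n)) fun k _ => hlt k
      rw [Finset.sum_const, Finset.card_univ, Fintype.card_fin, nsmul_eq_mul,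
        mul_div_cancel₀ _ hnpos.ne'] at h2
      linarith
    · exact ⟨1, one_pos, fun w hw => absurd ⟨w, hw⟩ hne⟩
  -- choose a neighbourhood
  have hev : ∀ᶠ t in nhds (0 : ℝ), ∀ U : Finset (Fin n),
      (volume (Δ (t • e U))).toReal = MvPolynomial.eval (t • e U) P := by
    rw [Filter.eventually_all]
    intro U
    have hc : Filter.Tendsto (fun t : ℝ => t • e U) (nhds 0) (nhds 0) := by
      have : Continuous fun t : ℝ => t • e U := by fun_prop
      simpa using this.tendsto 0
    exact hc.eventually hP
  have hev2 : ∀ᶠ t in nhds (0 : ℝ), t * n < γ := by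
    have : Continuous fun t : ℝ => t * n := by fun_prop
    have := this.tendsto 0
    rw [zero_mul] at this
    exact this.eventually (gt_mem_nhds hγ)
  obtain ⟨η, hη, hball⟩ := Metric.eventually_nhds_iff.1 (hev.and hev2)
  refine coeff_zero Finset.univ (fun U : Finset (Fin n) => (-1 : ℝ) ^ U.card) e P n η hη ?_
  intro t ht0 htη
  obtain ⟨hvol, htn⟩ := hball (y := t) (by simpa [abs_of_pos ht0] using htη)
  have hmeas : ∀ ε, MeasurableSet (Δ ε) := by
    intro ε
    rw [hΔ, Set.ofPred_forall]
    exact MeasurableSet.iInter fun i => (isClosed_le continuous_const (hcont i)).measurableSet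
  have hsub : ∀ U, Δ (t • e U) ⊆ Δ 0 := by
    intro U w hw
    rw [hΔ] at hw ⊢
    intro i
    have h1 := hw i
    have h2 := mul_nonneg ht0.le (he0 U i)
    simp only [Pi.smul_apply, smul_eq_mul, Pi.zero_apply] at h1 ⊢
    linarith
  have hfin : ∀ U, volume (Δ (t • e U)) ≠ ⊤ := fun U =>
    ((measure_mono (hsub U)).trans_lt hcompact.measure_lt_top).ne
  have hint' : ∀ U, (volume (Δ (t • e U))).toReal =
      ∫ w, (Δ (t • e U)).indicator (1 : (Fin n → ℝ) → ℝ) w := by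
    intro U
    rw [integral_indicator_one (hmeas _)]
    rfl
  have hintegrable : ∀ U, Integrable ((Δ (t • e U)).indicator (1 : (Fin n → ℝ) → ℝ)) := by
    intro U
    rw [integrable_indicator_iff (hmeas _)]
    exact integrableOn_const (hfin U)
  simp_rw [← hvol, hint', ← integral_const_mul]
  rw [← integral_finset_sum _ fun U _ => (hintegrable U).const_mul _]
  rw [← integral_zero (Fin n → ℝ) ℝ]
  congr 1
  funext w
  by_cases hw : w ∈ Δ 0
  · obtain ⟨k, hk⟩ := hgap w hw
    apply sum_toggle _ k
    intro U hU
    have hiff : w ∈ Δ (t • e (insert k U)) ↔ w ∈ Δ (t • e U) := by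
      rw [hΔ, hΔ]
      refine forall_congr' fun i => ?_
      by_cases hi : i = δ k
      · subst hi
        have a1 := mul_le_mul_of_nonneg_left (hen U (δ k)) ht0.le
        have a2 := mul_le_mul_of_nonneg_left (hen (insert k U) (δ k)) ht0.le
        simp only [Pi.smul_apply, smul_eq_mul]
        constructor <;> intro _ <;> linarith
      · have : e (insert k U) i = e U i := by
          simp only [he]
          rw [Finset.sum_insert hU]
          simp [hi]
        simp [this]
    simp only [Set.indicator, hiff]
  · apply Finset.sum_eq_zero
    intro U _
    rw [Set.indicator_of_notMem fun h => hw (hsub U h), mul_zero]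
end
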